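/- Let ξ = (x, y, z) : I → ℝ³ be a unit-speed spherical curve on an open interval I with z'(s) ≠ 0 for all s ∈ I, let a ≠ 0 and b ∈ ℝ, and suppose its spherical angular momentum satisfies 𝒦(s) = a·z(s)² + b·z(s) for all s ∈ I. Then its geodesic curvature satisfies κ(s) = 2a·z(s) + b for all s ∈ I, and κ satisfies the λ-elastic equation with λ = −b: 2κ''(s) + κ(s)³ + (2 − b²)·κ(s) − 2b = 0 for all s ∈ I. (The λ-elastic curves are the only spherical curves, up to rotations around the z-axis, with spherical angular momentum 𝒦(z) = a·z² + b·z, λ = −b.) -/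

import Mathlib

open Real Set

/-- Geodesic curvature of a unit-speed spherical curve with components `x, y, z`:
`κ(s) = det(ξ(s), ξ'(s), ξ''(s))`. -/
noncomputable def sphCurv (x y z : ℝ → ℝ) (s : ℝ) : ℝ :=
  Matrix.det !![x s, y s, z s;
                deriv x s, deriv y s, deriv z s;
                deriv (deriv x) s, deriv (deriv y) s, deriv (deriv z) s]

/-- Spherical angular momentum `𝒦(s) = x'(s)·y(s) − x(s)·y'(s)`. -/
noncomputable def sphMom (x y : ℝ → ℝ) (s : ℝ) : ℝ :=
  deriv x s * y s - x s * deriv y s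

/-- Frame decomposition of the acceleration of a unit-speed spherical curve. -/
lemma frame_aux (x y z x1 y1 z1 x2 y2 z2 k : ℝ)
    (h1 : x ^ 2 + y ^ 2 + z ^ 2 = 1) (h2 : x1 ^ 2 + y1 ^ 2 + z1 ^ 2 = 1)
    (h3 : x * x1 + y * y1 + z * z1 = 0)
    (h4 : x * x2 + y * y2 + z * z2 = -1) (h5 : x1 * x2 + y1 * y2 + z1 * z2 = 0)
    (hk : k = (y * z1 - z * y1) * x2 + (z * x1 - x * z1) * y2 + (x * y1 - y * x1) * z2) :
    x2 = -x + k * (y * z1 - z * y1) ∧ y2 = -y + k * (z * x1 - x * z1) ∧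
      z2 = -z + k * (x * y1 - y * x1) := by
  have hn : (y * z1 - z * y1) ^ 2 + (z * x1 - x * z1) ^ 2 + (x * y1 - y * x1) ^ 2 = 1 := by
    linear_combination (x1 ^ 2 + y1 ^ 2 + z1 ^ 2) * h1 + h2
      - (x * x1 + y * y1 + z * z1) * h3
  have hM : !![x, y, z; x1, y1, z1; y * z1 - z * y1, z * x1 - x * z1, x * y1 - y * x1] *
      (!![x, y, z; x1, y1, z1; y * z1 - z * y1, z * x1 - x * z1, x * y1 - y * x1]).transpose
        = (1 : Matrix (Fin 3) (Fin 3) ℝ) := by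
    ext i j
    fin_cases i <;> fin_cases j <;>
      simp [Matrix.mul_apply, Fin.sum_univ_three, Matrix.one_apply] <;>
      first
        | linear_combination h1
        | linear_combination h2
        | linear_combination h3
        | linear_combination hn
        | ring
  have hM' := mul_eq_one_comm.mp hM
  have e := fun i j => congrFun (congrFun hM' i) j
  have e00 := e 0 0
  have e01 := e 0 1
  have e02 := e 0 2
  have e11 := e 1 1
  have e12 := e 1 2
  have e22 := e 2 2
  simp [Matrix.mul_apply, Fin.sum_univ_three, Matrix.one_apply] at e00 e01 e02 e11 e12 e22
  subst hk
  refine ⟨?_, ?_, ?_⟩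
  · linear_combination x * h4 + x1 * h5 - x2 * e00 - y2 * e01 - z2 * e02
  · linear_combination y * h4 + y1 * h5 - x2 * e01 - y2 * e11 - z2 * e12
  · linear_combination z * h4 + z1 * h5 - x2 * e02 - y2 * e12 - z2 * e22

/-- Derivative facts from `C²` on an open interval. -/
lemma deriv_aux {t₀ t₁ : ℝ} {f : ℝ → ℝ} (hf : ContDiffOn ℝ 2 f (Ioo t₀ t₁)) {s : ℝ}
    (hs : s ∈ Ioo t₀ t₁) :
    HasDerivAt f (deriv f s) s ∧ HasDerivAt (deriv f) (deriv (deriv f) s) s := by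
  have h1 : ContDiffOn ℝ 1 (deriv f) (Ioo t₀ t₁) :=
    hf.deriv_of_isOpen isOpen_Ioo (by norm_num)
  have hn := isOpen_Ioo.mem_nhds hs
  exact ⟨((hf.differentiableOn (by norm_num)).differentiableAt hn).hasDerivAt,
    ((h1.differentiableOn (by norm_num)).differentiableAt hn).hasDerivAt⟩

/-- Two functions agreeing on an open interval have equal derivatives there. -/
lemma eq_deriv_aux {t₀ t₁ : ℝ} {f g : ℝ → ℝ} (h : ∀ s ∈ Ioo t₀ t₁, f s = g s) {s : ℝ}
    (hs : s ∈ Ioo t₀ t₁) {f' g' : ℝ} (hf : HasDerivAt f f' s) (hg : HasDerivAt g g' s) :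
    f' = g' := by
  have he : f =ᶠ[nhds s] g := Filter.eventually_of_mem (isOpen_Ioo.mem_nhds hs) h
  exact hf.unique (hg.congr_of_eventuallyEq he)

/-- A unit-speed spherical curve with nonconstant `z` and angular momentum
`𝒦 = a·z² + b·z` has curvature `κ = 2a·z + b` and is a `λ`-elastic curve with `λ = −b`:
`2κ'' + κ³ + (2 − b²)κ − 2b = 0`. -/
theorem lambda_elastic_characterization (t₀ t₁ : ℝ) (x y z : ℝ → ℝ) (a b : ℝ) (ha : a ≠ 0)
    (hx : ContDiffOn ℝ 2 x (Ioo t₀ t₁)) (hy : ContDiffOn ℝ 2 y (Ioo t₀ t₁))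
    (hz : ContDiffOn ℝ 2 z (Ioo t₀ t₁))
    (hsph : ∀ s ∈ Ioo t₀ t₁, x s ^ 2 + y s ^ 2 + z s ^ 2 = 1)
    (hunit : ∀ s ∈ Ioo t₀ t₁, deriv x s ^ 2 + deriv y s ^ 2 + deriv z s ^ 2 = 1)
    (hz' : ∀ s ∈ Ioo t₀ t₁, deriv z s ≠ 0)
    (hK : ∀ s ∈ Ioo t₀ t₁, sphMom x y s = a * z s ^ 2 + b * z s) :
    (∀ s ∈ Ioo t₀ t₁, sphCurv x y z s = 2 * a * z s + b) ∧
    (∀ s ∈ Ioo t₀ t₁,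
      2 * deriv (deriv (sphCurv x y z)) s + sphCurv x y z s ^ 3 +
        (2 - b ^ 2) * sphCurv x y z s - 2 * b = 0) := by
  have key : ∀ s ∈ Ioo t₀ t₁, sphCurv x y z s = 2 * a * z s + b ∧
      deriv (deriv z) s = - z s - sphCurv x y z s * (a * z s ^ 2 + b * z s) := by
    have hpv : ∀ s ∈ Ioo t₀ t₁, x s * deriv x s + y s * deriv y s + z s * deriv z s = 0 := by
      intro s hs
      obtain ⟨dx, -⟩ := deriv_aux hx hs
      obtain ⟨dy, -⟩ := deriv_aux hy hs
      obtain ⟨dz, -⟩ := deriv_aux hz hs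
      have := eq_deriv_aux hsph hs (((dx.fun_pow 2).fun_add (dy.fun_pow 2)).fun_add
        (dz.fun_pow 2)) (hasDerivAt_const s 1)
      norm_num at this
      linear_combination this / 2
    intro s hs
    obtain ⟨dx, dx'⟩ := deriv_aux hx hs
    obtain ⟨dy, dy'⟩ := deriv_aux hy hs
    obtain ⟨dz, dz'⟩ := deriv_aux hz hs
    have h5 := eq_deriv_aux hunit hs (((dx'.fun_pow 2).fun_add (dy'.fun_pow 2)).fun_add
        (dz'.fun_pow 2)) (hasDerivAt_const s 1)
    norm_num at h5
    have h4 := eq_deriv_aux hpv hs (((dx.fun_mul dx').fun_add (dy.fun_mul dy')).fun_add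
        (dz.fun_mul dz')) (hasDerivAt_const s 0)
    have hK0 := hK s hs
    have hK1 := eq_deriv_aux (f := fun s => deriv x s * y s - x s * deriv y s) hK hs
      ((dx'.fun_mul dy).fun_sub (dx.fun_mul dy'))
      (((dz.fun_pow 2).const_mul a).fun_add (dz.const_mul b))
    norm_num at hK1
    have h1 := hsph s hs
    have h2 := hunit s hs
    have h3 := hpv s hs
    have hz1 := hz' s hs
    have hk : sphCurv x y z s = (y s * deriv z s - z s * deriv y s) * deriv (deriv x) s
        + (z s * deriv x s - x s * deriv z s) * deriv (deriv y) s
        + (x s * deriv y s - y s * deriv x s) * deriv (deriv z) s := by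
      simp [sphCurv, Matrix.det_fin_three]
      ring
    simp only [sphMom] at hK0
    obtain ⟨ex, ey, ez⟩ := frame_aux _ _ _ _ _ _ _ _ _ _ h1 h2 h3
      (by linear_combination h4 - h2) (by linear_combination h5 / 2) hk
    refine ⟨?_, ?_⟩
    · apply mul_right_cancel₀ hz1
      generalize sphCurv x y z s = k at *
      linear_combination hK1 - y s * ex + x s * ey - k * deriv z s * h1 + k * z s * h3
    · linear_combination ez - sphCurv x y z s * hK0
  refine ⟨fun s hs => (key s hs).1, fun s hs => ?_⟩
  have hd : ∀ s ∈ Ioo t₀ t₁, deriv (sphCurv x y z) s = 2 * a * deriv z s := by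
    intro s hs
    have he : sphCurv x y z =ᶠ[nhds s] fun s => 2 * a * z s + b :=
      Filter.eventually_of_mem (isOpen_Ioo.mem_nhds hs) fun s hs => (key s hs).1
    exact ((((deriv_aux hz hs).1.const_mul (2 * a)).add_const b).congr_of_eventuallyEq he).deriv
  have he : deriv (sphCurv x y z) =ᶠ[nhds s] fun s => 2 * a * deriv z s :=
    Filter.eventually_of_mem (isOpen_Ioo.mem_nhds hs) hd
  have hdd := (((deriv_aux hz hs).2.const_mul (2 * a)).congr_of_eventuallyEq he).deriv
  obtain ⟨k1, k2⟩ := key s hs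
  rw [hdd, k2, k1]
  ring
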